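/- Let p > 3 be an odd prime. Then Σ_{γ ∈ F_p} ( Σ_{α ∈ F_p} φ(α² − 1)·φ((α+γ)² − 1) )² = p² − 3p + 1 + Σ_{γ ∈ F_p \ {0,1,−1}} a_p(γ²)², where a_p(λ) := −Σ_{x ∈ F_p} φ(x(x−1)(x−λ)). -/

import Mathlib

open Finset

open scoped Classical in
/-- The quadratic character of `F_p`, with `φ(0) = 0`. -/
noncomputable def phi (p : ℕ) (a : ZMod p) : ℤ :=
  if a = 0 then 0 else if IsSquare a then 1 else -1

/-- The trace of Frobenius of the Legendre elliptic curve `y² = x(x−1)(x−λ)`: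
`a_p(λ) = −Σ_{x ∈ F_p} φ(x(x−1)(x−λ))`. -/
noncomputable def ap (p : ℕ) [NeZero p] (l : ZMod p) : ℤ :=
  -∑ x : ZMod p, phi p (x * (x - 1) * (x - l))

section FiniteField

variable {F : Type*} [Field F] [Fintype F] [DecidableEq F]

/-- The trace of Frobenius of the Legendre curve `y² = x(x-1)(x-l)` over a finite field. -/
def legendreTrace (l : F) : ℤ := -∑ x : F, quadraticChar F (x * (x - 1) * (x - l))

lemma sum_comp_sq (hF : ringChar F ≠ 2) (f : F → ℤ) :
    ∑ t : F, f (t ^ 2) = ∑ u : F, (1 + quadraticChar F u) * f u := by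
  rw [← Finset.sum_fiberwise_of_maps_to (s := univ) (t := univ) (g := fun t : F => t ^ 2)
    (fun _ _ => mem_univ _)]
  refine Finset.sum_congr rfl fun u _ => ?_
  have hcard := quadraticChar_card_sqrts hF u
  have hset : {x : F | x ^ 2 = u}.toFinset = univ.filter (fun t : F => t ^ 2 = u) := by
    ext; simp
  rw [hset] at hcard
  rw [Finset.sum_congr rfl (g := fun _ => f u) (fun t ht => by rw [(mem_filter.mp ht).2]),
    Finset.sum_const, nsmul_eq_mul, hcard, add_comm]

lemma sum_quadraticChar_sub (hF : ringChar F ≠ 2) (a : F) :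
    ∑ u : F, quadraticChar F (u - a) = 0 :=
  (Fintype.sum_equiv (Equiv.subRight a) _ _ fun _ => rfl).trans (quadraticChar_sum_zero hF)

lemma quadraticChar_mul_self {b : F} (hb : b ≠ 0) : quadraticChar F b * quadraticChar F b = 1 := by
  rw [← sq, quadraticChar_sq_one hb]

lemma sum_quadraticChar_mul_sub (hF : ringChar F ≠ 2) {a b : F} (hab : a ≠ b) :
    ∑ u : F, quadraticChar F ((u - a) * (u - b)) = -1 := by
  have hba : b - a ≠ 0 := sub_ne_zero.mpr hab.symm
  have hJ := jacobiSum_nontrivial_inv (quadraticChar_ne_one hF)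
  rw [(quadraticChar_isQuadratic F).inv, jacobiSum] at hJ
  have hsq : quadraticChar F (-1) * quadraticChar F (-1) = 1 :=
    quadraticChar_mul_self (neg_ne_zero.mpr one_ne_zero)
  have hsub : ∑ u : F, quadraticChar F ((u - a) * (u - b)) =
      ∑ x : F, quadraticChar F (-1) * (quadraticChar F x * quadraticChar F (1 - x)) := by
    refine (Fintype.sum_equiv ((Equiv.mulLeft₀ (b - a) hba).trans (Equiv.addLeft a)) _ _
      fun x => ?_).symm
    have hx : (a + (b - a) * x - a) * (a + (b - a) * x - b) =
        (b - a) * (b - a) * (-1 * (x * (1 - x))) := by ring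
    simp only [Equiv.trans_apply, Equiv.mulLeft₀_apply, Equiv.coe_addLeft]
    rw [hx, map_mul, map_mul, quadraticChar_mul_self hba, one_mul, map_mul, map_mul]
  rw [hsub, ← Finset.mul_sum, hJ, mul_neg, hsq]

lemma sum_quadraticChar_sq_sub (hF : ringChar F ≠ 2) {d : F} (hd : d ≠ 0) :
    ∑ t : F, quadraticChar F (t ^ 2 - d) = -1 := by
  have h := sum_quadraticChar_mul_sub hF hd.symm
  simp only [sub_zero, map_mul] at h
  rw [sum_comp_sq hF (fun u => quadraticChar F (u - d))]
  simp only [add_mul, one_mul, Finset.sum_add_distrib]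
  rw [sum_quadraticChar_sub hF, h, zero_add]

lemma sum_quadraticChar_biquadratic (hF : ringChar F ≠ 2) {l : F} (hl : l ≠ 1) :
    ∑ t : F, quadraticChar F ((t ^ 2 - l) * (t ^ 2 - 1)) = -1 - legendreTrace l := by
  rw [sum_comp_sq hF (fun u => quadraticChar F ((u - l) * (u - 1)))]
  simp only [add_mul, one_mul, Finset.sum_add_distrib]
  rw [sum_quadraticChar_mul_sub hF hl, legendreTrace, sub_neg_eq_add]
  congr 1
  refine Finset.sum_congr rfl fun x _ => ?_
  rw [← map_mul]
  congr 1
  ring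

lemma sum_quadraticChar_sq_sub_sq (hF : ringChar F ≠ 2) {a b : F} (hb : b ≠ 0)
    (hab : a ^ 2 ≠ b ^ 2) :
    ∑ t : F, quadraticChar F ((t ^ 2 - a ^ 2) * (t ^ 2 - b ^ 2)) =
      -1 - legendreTrace ((a / b) ^ 2) := by
  have hl : (a / b) ^ 2 ≠ 1 := by
    rw [div_pow, Ne, div_eq_one_iff_eq (pow_ne_zero 2 hb)]
    exact hab
  rw [← sum_quadraticChar_biquadratic hF hl]
  refine (Fintype.sum_equiv (Equiv.mulLeft₀ b hb) _ _ fun t => ?_).symm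
  have ht : ((b * t) ^ 2 - a ^ 2) * ((b * t) ^ 2 - b ^ 2) =
      b ^ 2 * b ^ 2 * ((t ^ 2 - (a / b) ^ 2) * (t ^ 2 - 1)) := by
    field_simp
  rw [Equiv.mulLeft₀_apply, ht, map_mul (quadraticChar F) (b ^ 2 * b ^ 2),
    map_mul (quadraticChar F) (b ^ 2), quadraticChar_mul_self (pow_ne_zero 2 hb), one_mul]

lemma sum_quadraticChar_sq_sub_one_mul_self (hF : ringChar F ≠ 2) :
    ∑ t : F, quadraticChar F ((t ^ 2 - 1) * (t ^ 2 - 1)) = Fintype.card F - 2 := by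
  have hpt (u : F) : quadraticChar F ((u - 1) * (u - 1)) = 1 - if u = 1 then 1 else 0 := by
    split_ifs with hu
    · simp [hu]
    · rw [map_mul, quadraticChar_mul_self (sub_ne_zero.mpr hu), sub_zero]
  rw [sum_comp_sq hF (fun u => quadraticChar F ((u - 1) * (u - 1)))]
  simp only [hpt]
  simp only [mul_sub, mul_one, mul_ite, mul_zero, Finset.sum_sub_distrib,
    Finset.sum_add_distrib, quadraticChar_sum_zero hF, Finset.sum_ite_eq', mem_univ, if_true,
    map_one]
  simp

lemma legendreTrace_zero (hF : ringChar F ≠ 2) :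
    legendreTrace (0 : F) = quadraticChar F (-1) := by
  have hpt (x : F) : quadraticChar F (x * (x - 1) * (x - 0)) =
      quadraticChar F (x - 1) - if x = 0 then quadraticChar F (-1) else 0 := by
    split_ifs with hx
    · simp [hx]
    · rw [show x * (x - 1) * (x - 0) = x * x * (x - 1) by ring, map_mul, map_mul,
        quadraticChar_mul_self hx, one_mul, sub_zero]
  rw [legendreTrace]
  simp only [hpt, Finset.sum_sub_distrib, sum_quadraticChar_sub hF, Finset.sum_ite_eq', mem_univ,
    if_true]
  ring

lemma legendreTrace_one (hF : ringChar F ≠ 2) : legendreTrace (1 : F) = 1 := by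
  have hpt (x : F) : quadraticChar F (x * (x - 1) * (x - 1)) =
      quadraticChar F x - if x = 1 then 1 else 0 := by
    split_ifs with hx
    · simp [hx]
    · rw [mul_assoc, map_mul, map_mul, quadraticChar_mul_self (sub_ne_zero.mpr hx), mul_one,
        sub_zero]
  rw [legendreTrace]
  simp only [hpt, Finset.sum_sub_distrib, quadraticChar_sum_zero hF, Finset.sum_ite_eq', mem_univ,
    if_true]
  ring

lemma sum_legendreTrace_sq (hF : ringChar F ≠ 2) :
    ∑ k : F, legendreTrace (k ^ 2) = -quadraticChar F (-1) := by
  have hinner (x : F) : ∑ k : F, quadraticChar F (x * (x - 1) * (x - k ^ 2)) =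
      -quadraticChar F (-1) * quadraticChar F ((x - 0) * (x - 1)) := by
    by_cases hx : x = 0
    · simp [hx]
    · have hk (k : F) : quadraticChar F (x * (x - 1) * (x - k ^ 2)) =
          quadraticChar F (-1) * quadraticChar F ((x - 0) * (x - 1)) *
            quadraticChar F (k ^ 2 - x) := by
        rw [← map_mul, ← map_mul]
        congr 1
        ring
      simp only [hk, ← Finset.mul_sum, sum_quadraticChar_sq_sub hF hx]
      ring
  simp only [legendreTrace, Finset.sum_neg_distrib]
  rw [Finset.sum_comm]
  simp only [hinner, ← Finset.mul_sum]
  rw [sum_quadraticChar_mul_sub hF zero_ne_one]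
  ring

lemma sum_eq_add_sum_ne_zero_one_neg_one (hF : ringChar F ≠ 2) (g : F → ℤ) :
    ∑ k : F, g k = g 0 + g 1 + g (-1) +
      ∑ k ∈ univ.filter (fun k : F => k ≠ 0 ∧ k ≠ 1 ∧ k ≠ -1), g k := by
  have hcompl : univ.filter (fun k : F => ¬(k ≠ 0 ∧ k ≠ 1 ∧ k ≠ -1)) = {0, 1, -1} := by
    ext k
    simp only [mem_filter, mem_univ, true_and, mem_insert, mem_singleton]
    tauto
  have h1 : (1 : F) ≠ -1 := (Ring.neg_one_ne_one_of_char_ne_two hF).symm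
  rw [← Finset.sum_filter_add_sum_filter_not univ (fun k : F => k ≠ 0 ∧ k ≠ 1 ∧ k ≠ -1), hcompl,
    Finset.sum_insert (by simp), Finset.sum_insert (by simpa using h1), Finset.sum_singleton]
  ring

lemma sum_comp_cayley (hF : ringChar F ≠ 2) (g : F → ℤ) :
    ∑ c ∈ univ.filter (fun k : F => k ≠ 0 ∧ k ≠ 1 ∧ k ≠ -1), g ((c + 1) / (c - 1)) =
      ∑ k ∈ univ.filter (fun k : F => k ≠ 0 ∧ k ≠ 1 ∧ k ≠ -1), g k := by
  have h2 : (2 : F) ≠ 0 := Ring.two_ne_zero hF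
  have hmem : ∀ c ∈ univ.filter (fun k : F => k ≠ 0 ∧ k ≠ 1 ∧ k ≠ -1),
      (c + 1) / (c - 1) ∈ univ.filter (fun k : F => k ≠ 0 ∧ k ≠ 1 ∧ k ≠ -1) := by
    intro c hc
    obtain ⟨h0, h1, hm⟩ := (mem_filter.mp hc).2
    have hd : c - 1 ≠ 0 := sub_ne_zero.mpr h1
    refine mem_filter.mpr ⟨mem_univ _, div_ne_zero (fun h => hm (eq_neg_of_add_eq_zero_left h)) hd,
      fun h => ?_, fun h => ?_⟩
    · rw [div_eq_iff hd] at h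
      exact h2 (by linear_combination h)
    · rw [div_eq_iff hd] at h
      exact mul_ne_zero h2 h0 (by linear_combination h)
  have hinv : ∀ c ∈ univ.filter (fun k : F => k ≠ 0 ∧ k ≠ 1 ∧ k ≠ -1),
      ((c + 1) / (c - 1) + 1) / ((c + 1) / (c - 1) - 1) = c := by
    intro c hc
    have hd : c - 1 ≠ 0 := sub_ne_zero.mpr (mem_filter.mp hc).2.2.1
    rw [div_add_one hd, div_sub_one hd, div_div_div_cancel_right₀ hd,
      show c + 1 + (c - 1) = 2 * c by ring, show c + 1 - (c - 1) = 2 by ring,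
      mul_div_cancel_left₀ c h2]
  exact Finset.sum_nbij' _ _ hmem hmem hinv hinv fun _ _ => rfl

lemma sum_quadraticChar_shift (c : F) :
    ∑ α : F, quadraticChar F (α ^ 2 - 1) * quadraticChar F ((α + 2 * c) ^ 2 - 1) =
      ∑ t : F, quadraticChar F ((t ^ 2 - (c + 1) ^ 2) * (t ^ 2 - (c - 1) ^ 2)) := by
  refine Fintype.sum_equiv (Equiv.addRight c) _ _ fun α => ?_
  rw [← map_mul, Equiv.coe_addRight]
  congr 1
  ring

theorem sum_sq_sum_quadraticChar (hF : ringChar F ≠ 2) :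
    ∑ γ : F, (∑ α : F, quadraticChar F (α ^ 2 - 1) * quadraticChar F ((α + γ) ^ 2 - 1)) ^ 2 =
      (Fintype.card F : ℤ) ^ 2 - 3 * Fintype.card F + 1 +
        ∑ k ∈ univ.filter (fun k : F => k ≠ 0 ∧ k ≠ 1 ∧ k ≠ -1), legendreTrace (k ^ 2) ^ 2 := by
  have h2 : (2 : F) ≠ 0 := Ring.two_ne_zero hF
  have hscale : ∑ γ : F,
        (∑ α : F, quadraticChar F (α ^ 2 - 1) * quadraticChar F ((α + γ) ^ 2 - 1)) ^ 2 =
      ∑ c : F, (∑ t : F, quadraticChar F ((t ^ 2 - (c + 1) ^ 2) * (t ^ 2 - (c - 1) ^ 2))) ^ 2 := by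
    refine (Fintype.sum_equiv (Equiv.mulLeft₀ 2 h2) _ _ fun c => ?_).symm
    rw [← sum_quadraticChar_shift, Equiv.mulLeft₀_apply]
  have hgen : ∀ c ∈ univ.filter (fun k : F => k ≠ 0 ∧ k ≠ 1 ∧ k ≠ -1),
      (∑ t : F, quadraticChar F ((t ^ 2 - (c + 1) ^ 2) * (t ^ 2 - (c - 1) ^ 2))) ^ 2 =
        (-1 - legendreTrace (((c + 1) / (c - 1)) ^ 2)) ^ 2 := by
    intro c hc
    obtain ⟨h0, h1, -⟩ := (mem_filter.mp hc).2
    rw [sum_quadraticChar_sq_sub_sq hF (sub_ne_zero.mpr h1) fun h => ?_]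
    exact mul_ne_zero (mul_ne_zero h2 h2) h0 (by linear_combination h)
  have hzero : ∑ t : F, quadraticChar F ((t ^ 2 - (0 + 1) ^ 2) * (t ^ 2 - (0 - 1) ^ 2)) =
      Fintype.card F - 2 := by
    simpa using sum_quadraticChar_sq_sub_one_mul_self hF
  have hdeg {b : F} (hb : b ≠ 0) :
      ∑ t : F, quadraticChar F ((t ^ 2 - 0 ^ 2) * (t ^ 2 - b ^ 2)) =
        -1 - quadraticChar F (-1) := by
    rw [sum_quadraticChar_sq_sub_sq hF hb (by simpa using (pow_ne_zero 2 hb).symm), zero_div,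
      zero_pow two_ne_zero, legendreTrace_zero hF]
  have hone : ∑ t : F, quadraticChar F ((t ^ 2 - (1 + 1) ^ 2) * (t ^ 2 - (1 - 1) ^ 2)) =
      -1 - quadraticChar F (-1) := by
    rw [← hdeg h2]
    refine Finset.sum_congr rfl fun t _ => ?_
    congr 1
    ring
  have hneg : ∑ t : F, quadraticChar F ((t ^ 2 - (-1 + 1) ^ 2) * (t ^ 2 - (-1 - 1) ^ 2)) =
      -1 - quadraticChar F (-1) := by
    rw [← hdeg h2]
    refine Finset.sum_congr rfl fun t _ => ?_
    congr 1
    ring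
  have htrace := sum_eq_add_sum_ne_zero_one_neg_one hF (fun k : F => legendreTrace (k ^ 2))
  simp only [zero_pow two_ne_zero, one_pow, neg_one_sq, legendreTrace_zero hF,
    legendreTrace_one hF, sum_legendreTrace_sq hF] at htrace
  have hcard := sum_eq_add_sum_ne_zero_one_neg_one hF (fun _ : F => (1 : ℤ))
  rw [Finset.sum_const, card_univ, nsmul_eq_mul, mul_one] at hcard
  have hsq : quadraticChar F (-1) * quadraticChar F (-1) = 1 :=
    quadraticChar_mul_self (neg_ne_zero.mpr one_ne_zero)
  have hexpand (k : F) : (-1 - legendreTrace (k ^ 2)) ^ 2 =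
      1 + 2 * legendreTrace (k ^ 2) + legendreTrace (k ^ 2) ^ 2 := by ring
  rw [hscale, sum_eq_add_sum_ne_zero_one_neg_one hF, hzero, hone, hneg,
    Finset.sum_congr rfl hgen, sum_comp_cayley hF (fun k => (-1 - legendreTrace (k ^ 2)) ^ 2)]
  simp only [hexpand, Finset.sum_add_distrib, ← Finset.mul_sum]
  linear_combination 2 * hsq - hcard - 2 * htrace

end FiniteField

lemma phi_eq_quadraticChar (p : ℕ) [Fact p.Prime] (a : ZMod p) :
    phi p a = quadraticChar (ZMod p) a := by
  classical
  rw [phi, quadraticChar_apply, quadraticCharFun]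
  split_ifs <;> rfl

/-- `Σ_γ (Σ_α φ(α²−1)φ((α+γ)²−1))² = p² − 3p + 1 + Σ_{γ ∈ F_p∖{0,±1}} a_p(γ²)²`. -/
theorem character_sum_square_formula (p : ℕ) (hp : p.Prime) (h3 : 3 < p) :
    haveI : NeZero p := ⟨hp.ne_zero⟩
    (∑ γ : ZMod p, (∑ α : ZMod p, phi p (α ^ 2 - 1) * phi p ((α + γ) ^ 2 - 1)) ^ 2) =
      (p : ℤ) ^ 2 - 3 * (p : ℤ) + 1 +
      ∑ γ ∈ Finset.univ.filter (fun γ : ZMod p => γ ≠ 0 ∧ γ ≠ 1 ∧ γ ≠ -1),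
        (ap p (γ ^ 2)) ^ 2 := by
  have : Fact p.Prime := ⟨hp⟩
  have hF : ringChar (ZMod p) ≠ 2 := by
    rw [ZMod.ringChar_zmod_n]
    lia
  have h := sum_sq_sum_quadraticChar hF
  rw [ZMod.card] at h
  simpa only [ap, phi_eq_quadraticChar, legendreTrace] using h
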